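/- For any monomial ideal M in ℂ[z_1,…,z_n], the monomial ideal generated by {z^α : α ∈ NP(M) ∩ ℕ^n} is integrally closed, and it equals the integral closure of M. Consequently the integral closure of a monomial ideal is again a monomial ideal. -/

import Mathlib

open MvPolynomial

noncomputable section

abbrev MPoly (n : ℕ) : Type := MvPolynomial (Fin n) ℂ

def monom {n : ℕ} (β : Fin n → ℕ) : MPoly n := ∏ i, X i ^ β i

def memIntClosure {R : Type*} [CommRing R] (I : Ideal R) (g : R) : Prop :=
  ∃ q : ℕ, 0 < q ∧ ∃ h : Fin q → R, (∀ k, h k ∈ I ^ (k.1 + 1)) ∧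
    g ^ q + ∑ k, h k * g ^ (q - 1 - k.1) = 0

def NP {n : ℕ} (M : Ideal (MPoly n)) : Set (Fin n → ℝ) :=
  convexHull ℝ {x | ∃ β : Fin n → ℕ, monom β ∈ M ∧ x = fun i => (β i : ℝ)}

abbrev castV {n : ℕ} (d : Fin n → ℕ) : Fin n → ℝ := fun i => (d i : ℝ)

lemma castV_add {n : ℕ} (a b : Fin n → ℕ) : castV (a + b) = castV a + castV b := by
  ext i; simp [castV]

lemma monom_add {n : ℕ} (a b : Fin n → ℕ) : monom (a + b) = monom a * monom b := by
  simp [monom, pow_add, Finset.prod_mul_distrib]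

lemma monom_eq {n : ℕ} (a : Fin n →₀ ℕ) : monom (⇑a) = monomial a (1:ℂ) := by
  rw [monomial_eq, Finsupp.prod_fintype _ _ (by simp)]
  simp [monom]

lemma monom_eq' {n : ℕ} (a : Fin n → ℕ) :
    monom a = monomial (Finsupp.equivFunOnFinite.symm a) (1:ℂ) := by
  rw [← monom_eq]; rfl

/-- support condition -/
def SuppIn {n : ℕ} (L : (Fin n → ℝ) →L[ℝ] ℝ) (U : Set ℝ) (p : MPoly n) : Prop :=
  ∀ d : Fin n →₀ ℕ, coeff d p ≠ 0 → L (castV ⇑d) ∈ U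

section supp
variable {n : ℕ} {L : (Fin n → ℝ) →L[ℝ] ℝ}

lemma SuppIn.zero {U : Set ℝ} : SuppIn L U 0 := by
  intro d hd; simp at hd

lemma SuppIn.add {U : Set ℝ} {p q : MPoly n} (hp : SuppIn L U p) (hq : SuppIn L U q) :
    SuppIn L U (p + q) := by
  intro d hd
  by_cases h : coeff d p = 0
  · apply hq; intro h'; simp [h, h'] at hd
  · exact hp d h

lemma SuppIn.neg {U : Set ℝ} {p : MPoly n} (hp : SuppIn L U p) : SuppIn L U (-p) := by
  intro d hd
  apply hp; simpa using hd

lemma SuppIn.sum {ι : Type*} {s : Finset ι} {U : Set ℝ} {p : ι → MPoly n}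
    (hp : ∀ i ∈ s, SuppIn L U (p i)) : SuppIn L U (∑ i ∈ s, p i) :=
  Finset.sum_induction p (SuppIn L U) (fun _ _ => SuppIn.add) SuppIn.zero hp

lemma SuppIn.mul {U V T : Set ℝ} {p q : MPoly n} (hp : SuppIn L U p) (hq : SuppIn L V q)
    (h : ∀ u ∈ U, ∀ v ∈ V, u + v ∈ T) : SuppIn L T (p * q) := by
  intro d hd
  rw [coeff_mul] at hd
  obtain ⟨⟨a, b⟩, hab, hne⟩ := Finset.exists_ne_zero_of_sum_ne_zero hd
  rw [Finset.HasAntidiagonal.mem_antidiagonal] at hab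
  have h1 := hp a (left_ne_zero_of_mul hne)
  have h2 := hq b (right_ne_zero_of_mul hne)
  have h3 := h _ h1 _ h2
  rw [← map_add, ← castV_add] at h3
  simp only at hab
  rw [← hab]
  exact h3

lemma SuppIn.one : SuppIn L {0} 1 := by
  intro d hd
  rw [coeff_one] at hd
  have : d = 0 := by
    by_contra h
    exact hd (if_neg (Ne.symm h))
  subst this
  have : castV (⇑(0 : Fin n →₀ ℕ)) = 0 := by ext i; simp [castV]
  rw [this]; simp

lemma SuppIn.mono {U V : Set ℝ} {p : MPoly n} (hp : SuppIn L U p) (h : U ⊆ V) :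
    SuppIn L V p := fun d hd => h (hp d hd)

lemma SuppIn.pow_single {m : ℝ} {p : MPoly n} (hp : SuppIn L {m} p) (k : ℕ) :
    SuppIn L {k * m} (p ^ k) := by
  induction k with
  | zero => simpa using SuppIn.one
  | succ k ih =>
    rw [pow_succ]
    refine ih.mul hp ?_
    rintro u rfl v rfl
    simp; ring

lemma SuppIn.pow_ici {m : ℝ} {p : MPoly n} (hp : SuppIn L (Set.Ici m) p) (k : ℕ) :
    SuppIn L (Set.Ici (k * m)) (p ^ k) := by
  induction k with
  | zero => simpa using (SuppIn.one (L := L)).mono (by simp)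
  | succ k ih =>
    rw [pow_succ]
    refine ih.mul hp ?_
    intro u hu v hv
    simp only [Set.mem_Ici] at *
    push_cast; linarith

lemma SuppIn.pow_sub {m : ℝ} {p r : MPoly n} (hp : SuppIn L (Set.Ici m) p)
    (hr : SuppIn L {m} r) (h : SuppIn L (Set.Ioi m) (p - r)) (k : ℕ) :
    SuppIn L (Set.Ioi (k * m)) (p ^ k - r ^ k) := by
  induction k with
  | zero => simpa using SuppIn.zero
  | succ k ih =>
    have : p ^ (k+1) - r ^ (k+1) = p ^ k * (p - r) + (p ^ k - r ^ k) * r := by ring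
    rw [this]
    refine SuppIn.add ((hp.pow_ici k).mul h ?_) (ih.mul hr ?_)
    · intro u hu v hv
      simp only [Set.mem_Ici, Set.mem_Ioi] at *
      push_cast; linarith
    · intro u hu v hv
      simp only [Set.mem_singleton_iff, Set.mem_Ioi] at *
      push_cast; linarith

/-- Powers of ideals. -/
lemma SuppIn.ideal_pow {c : ℝ} {J : Ideal (MPoly n)} (hJ : ∀ p ∈ J, SuppIn L (Set.Ici c) p)
    (hall : ∀ p : MPoly n, SuppIn L (Set.Ici 0) p) (k : ℕ) :
    ∀ p ∈ J ^ k, SuppIn L (Set.Ici (k * c)) p := by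
  induction k with
  | zero => intro p _; simpa using hall p
  | succ k ih =>
    intro p hp
    rw [pow_succ] at hp
    refine Submodule.mul_induction_on hp ?_ ?_
    · intro a ha b hb
      refine (ih a ha).mul (hJ b hb) ?_
      intro u hu v hv
      simp only [Set.mem_Ici] at *
      push_cast; linarith
    · intro a b ha hb
      exact ha.add hb

/-- The valuative argument. -/
lemma no_integral {c : ℝ} {J : Ideal (MPoly n)} (hJ : ∀ p ∈ J, SuppIn L (Set.Ici c) p)
    (hall : ∀ p : MPoly n, SuppIn L (Set.Ici 0) p) {g : MPoly n} (hg : memIntClosure J g) :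
    SuppIn L (Set.Ici c) g := by
  by_contra hcon
  unfold SuppIn at hcon
  push Not at hcon
  obtain ⟨d0, hd0, hd0c⟩ := hcon
  rw [Set.mem_Ici, not_le] at hd0c
  obtain ⟨d1, hd1, hmin⟩ := Finset.exists_min_image g.support (fun d => L (castV ⇑d))
    ⟨d0, mem_support_iff.2 hd0⟩
  set m := L (castV ⇑d1) with hm
  have hmc : m < c := lt_of_le_of_lt (hmin d0 (mem_support_iff.2 hd0)) hd0c
  have hgm : SuppIn L (Set.Ici m) g := fun d hd => hmin d (mem_support_iff.2 hd)
  classical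
  let g0 : MPoly n := ∑ d ∈ g.support.filter (fun d : Fin n →₀ ℕ => L (castV ⇑d) = m),
    monomial d (coeff d g)
  have hg0 : ∀ d, coeff d g0 = if L (castV ⇑d) = m then coeff d g else 0 := by
    intro d
    simp only [g0, coeff_sum, coeff_monomial, Finset.sum_ite_eq', Finset.mem_filter,
      mem_support_iff]
    by_cases h : coeff d g = 0 <;> simp [h]
  have hg0m : SuppIn L {m} g0 := by
    intro d hd
    rw [hg0] at hd
    by_contra h
    exact hd (if_neg h)
  have hsub : SuppIn L (Set.Ioi m) (g - g0) := by
    intro d hd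
    rw [coeff_sub, hg0] at hd
    split_ifs at hd with h
    · simp at hd
    · exact lt_of_le_of_ne (hgm d (by simpa using hd)) (Ne.symm h)
  obtain ⟨q, hq, h, hh, heq⟩ := hg
  have h1 := hgm.pow_sub hg0m hsub q
  have h2 : SuppIn L (Set.Ioi (q * m)) (∑ k, h k * g ^ (q - 1 - k.1)) := by
    refine SuppIn.sum fun k _ => ?_
    refine (SuppIn.ideal_pow hJ hall _ _ (hh k)).mul (hgm.pow_ici _) ?_
    intro u hu v hv
    simp only [Set.mem_Ici, Set.mem_Ioi] at *
    have hk : (q : ℝ) = ((k.1 + 1 : ℕ) : ℝ) + ((q - 1 - k.1 : ℕ) : ℝ) := by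
      have := k.2
      rw [← Nat.cast_add]; congr 1; omega
    have hpos : (0 : ℝ) < ((k.1 + 1 : ℕ) : ℝ) := by positivity
    have := mul_lt_mul_of_pos_left hmc hpos
    rw [hk, add_mul]; linarith
  have h3 : g0 ^ q = -((g ^ q - g0 ^ q) + ∑ k, h k * g ^ (q - 1 - k.1)) := by
    linear_combination heq
  have h4 : SuppIn L (Set.Ioi (q * m)) (g0 ^ q) := by
    rw [h3]; exact (h1.add h2).neg
  have h5 := hg0m.pow_single q
  have h6 : g0 ^ q = 0 := by
    ext d
    by_contra hd
    have e1 := h4 d hd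
    have e2 := h5 d hd
    simp only [Set.mem_singleton_iff, Set.mem_Ioi] at *
    linarith
  have h7 : g0 = 0 := eq_zero_of_pow_eq_zero h6
  have h8 := hg0 d1
  rw [h7, if_pos hm.symm] at h8
  exact mem_support_iff.1 hd1 (by simpa using h8.symm)

end supp

section np
variable {n : ℕ} {M : Ideal (MPoly n)}

lemma NP_add_nat {x : Fin n → ℝ} (hx : x ∈ NP M) (γ : Fin n → ℕ) : x + castV γ ∈ NP M := by
  have hconv : Convex ℝ {x : Fin n → ℝ | x + castV γ ∈ NP M} :=
    (convex_convexHull ℝ _).translate_preimage_left _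
  refine convexHull_min ?_ hconv hx
  rintro _ ⟨β, hβ, rfl⟩
  refine subset_convexHull ℝ _ ⟨β + γ, ?_, ?_⟩
  · rw [monom_add]; exact M.mul_mem_right _ hβ
  · ext i; simp [castV]

lemma NP_add_single {x : Fin n → ℝ} (hx : x ∈ NP M) (j : Fin n) {t : ℝ} (ht : 0 ≤ t) :
    x + Pi.single j t ∈ NP M := by
  obtain ⟨N, hN⟩ := exists_nat_gt t
  have hN0 : (0:ℝ) < N := lt_of_le_of_lt ht hN
  have h1 := NP_add_nat hx (Pi.single j N)
  have h2 : castV (Pi.single j N : Fin n → ℕ) = Pi.single j (N:ℝ) := by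
    ext i; by_cases h : i = j
    · subst h; simp [castV]
    · simp [castV, h]
  rw [h2] at h1
  have := (convex_convexHull ℝ _).add_smul_mem hx h1 (t := t / N)
    ⟨by positivity, by rw [div_le_one hN0]; exact hN.le⟩
  rw [← Pi.single_smul, smul_eq_mul, div_mul_cancel₀ _ hN0.ne'] at this
  exact this

lemma NP_add_nonneg {x y : Fin n → ℝ} (hx : x ∈ NP M) (hy : 0 ≤ y) : x + y ∈ NP M := by
  have key : ∀ s : Finset (Fin n), x + ∑ j ∈ s, Pi.single j (y j) ∈ NP M := by
    classical
    intro s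
    induction s using Finset.induction_on with
    | empty => simpa using hx
    | insert a s ha ih =>
      rw [Finset.sum_insert ha, add_comm (Pi.single _ _), ← add_assoc]
      exact NP_add_single ih _ (hy a)
  have := key Finset.univ
  rwa [Finset.univ_sum_single] at this

end np

open scoped Pointwise in
lemma partA {n : ℕ} {M : Ideal (MPoly n)} {J : Ideal (MPoly n)}
    (hJ : J = Ideal.span
      {p : MPoly n | ∃ α : Fin n → ℕ, (fun i => (α i : ℝ)) ∈ NP M ∧ p = monom α})
    (g : MPoly n) (hg : memIntClosure J g) : g ∈ J := by
  suffices hsup : ∀ d ∈ g.support, castV ⇑d ∈ NP M by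
    rw [g.as_sum]
    refine J.sum_mem fun d hd => ?_
    have : monomial d (coeff d g) = C (coeff d g) * monom ⇑d := by
      rw [monom_eq, C_mul_monomial, mul_one]
    rw [this]
    refine J.mul_mem_left _ ?_
    rw [hJ]
    exact Ideal.subset_span ⟨_, hsup d hd, rfl⟩
  intro d hd
  by_contra hdn
  have hfg : J.FG := IsNoetherian.noetherian J
  rw [hJ] at hfg
  obtain ⟨S, hS, hspan⟩ := Submodule.fg_span_iff_fg_span_finset_subset _ |>.1 hfg
  have hJS : J = Ideal.span (S : Set (MPoly n)) := by rw [hJ]; exact hspan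
  rcases S.eq_empty_or_nonempty with hE | hNE
  · have hJ0 : J = ⊥ := by rw [hJS, hE]; simp
    obtain ⟨q, hq, h, hh, heq⟩ := hg
    have : ∀ k, h k = 0 := by
      intro k
      have := hh k
      rw [hJ0, Ideal.bot_pow (by simp)] at this
      simpa using this
    simp only [this, zero_mul, Finset.sum_const_zero, add_zero] at heq
    have := eq_zero_of_pow_eq_zero heq
    simp [this] at hd
  have hS' : ∀ p : MPoly n, ∃ α : Fin n → ℕ, p ∈ S → castV α ∈ NP M ∧ p = monom α := by
    intro p
    by_cases hp : p ∈ S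
    · obtain ⟨α, h⟩ := hS hp
      exact ⟨α, fun _ => h⟩
    · exact ⟨0, fun h => absurd h hp⟩
  choose e he using hS'
  let F : Set (Fin n → ℝ) := (fun p => castV (e p)) '' (S : Set (MPoly n))
  have hF : F.Finite := S.finite_toSet.image _
  have hFNP : F ⊆ NP M := by
    rintro _ ⟨p, hp, rfl⟩
    exact (he p hp).1
  let T : Set (Fin n → ℝ) := convexHull ℝ F + Set.Ici (0 : Fin n → ℝ)
  have hTNP : T ⊆ NP M := by
    rintro _ ⟨x, hx, y, hy, rfl⟩
    exact NP_add_nonneg (convexHull_min hFNP (convex_convexHull ℝ _) hx) hy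
  have hTc : Convex ℝ T := (convex_convexHull ℝ F).add (convex_Ici 0)
  have hTcl : IsClosed T :=
    isClosed_Ici.add_left_of_isCompact (hF.isCompact_convexHull ℝ)
  obtain ⟨L, u, hLu, hLT⟩ := geometric_hahn_banach_point_closed hTc hTcl (fun h => hdn (hTNP h))
  have hLnn : ∀ y : Fin n → ℝ, 0 ≤ y → 0 ≤ L y := by
    intro y hy
    obtain ⟨p, hp⟩ := hNE
    by_contra hneg
    push Not at hneg
    have hx : castV (e p) ∈ convexHull ℝ F := subset_convexHull ℝ _ ⟨p, hp, rfl⟩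
    obtain ⟨N, hN⟩ := exists_nat_gt ((L (castV (e p)) - u) / (- L y))
    rw [div_lt_iff₀ (by linarith)] at hN
    have := hLT (castV (e p) + (N : ℝ) • y) ⟨_, hx, _, smul_nonneg (by positivity) hy, rfl⟩
    rw [map_add, map_smul, smul_eq_mul] at this
    linarith
  have hall : ∀ p : MPoly n, SuppIn L (Set.Ici 0) p := by
    intro p d _
    exact hLnn _ (fun i => by simp [castV])
  have hJu : ∀ p ∈ J, SuppIn L (Set.Ici u) p := by
    intro p hp
    rw [hJS] at hp
    refine Submodule.span_induction ?_ SuppIn.zero (fun _ _ _ _ => SuppIn.add) ?_ hp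
    · intro p hp d hd
      rw [(he p hp).2, monom_eq', coeff_monomial] at hd
      have hd' : Finsupp.equivFunOnFinite.symm (e p) = d := by
        by_contra h; exact hd (if_neg h)
      have : castV ⇑d = castV (e p) := by rw [← hd']; rfl
      rw [this]
      refine (hLT _ ⟨castV (e p), subset_convexHull ℝ _ ⟨p, hp, rfl⟩, 0, ?_, ?_⟩).le
      · simp
      · simp
    · intro a x _ hx
      rw [smul_eq_mul]
      refine (hall a).mul hx ?_
      intro u hu v hv
      simp only [Set.mem_Ici] at *
      linarith
  have := no_integral hJu hall hg d (mem_support_iff.1 hd)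
  rw [Set.mem_Ici] at this
  linarith

/-- Rees algebra criterion. -/
lemma memIntClosure_of_isIntegral {R : Type*} [CommRing R] [Nontrivial R] (I : Ideal R) (g : R)
    (h : IsIntegral (reesAlgebra I) (Polynomial.monomial 1 g : Polynomial R)) :
    memIntClosure I g := by
  obtain ⟨p, hp, hp0⟩ := h
  set P := p * Polynomial.X with hP
  have hPm : P.Monic := hp.mul Polynomial.monic_X
  have hPd : P.natDegree = p.natDegree + 1 := hp.natDegree_mul Polynomial.monic_X |>.trans (by simp)
  have hP0 : Polynomial.eval₂ (algebraMap (reesAlgebra I) (Polynomial R))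
      (Polynomial.monomial 1 g) P = 0 := by
    rw [hP, Polynomial.eval₂_mul, hp0, zero_mul]
  set q := P.natDegree with hq
  have hcoef := congrArg (fun f => Polynomial.coeff f q) hP0
  simp only [Polynomial.eval₂_eq_sum_range, Polynomial.finsetSum_coeff, Polynomial.coeff_zero]
    at hcoef
  have hterm : ∀ j ∈ Finset.range (q + 1), (algebraMap (reesAlgebra I) (Polynomial R) (P.coeff j) *
      (Polynomial.monomial 1 g) ^ j).coeff q =
      Polynomial.coeff (P.coeff j : Polynomial R) (q - j) * g ^ j := by
    intro j hj
    rw [Finset.mem_range] at hj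
    rw [Polynomial.monomial_pow, one_mul]
    have : q = (q - j) + j := by omega
    conv_lhs => rw [this]
    rw [Polynomial.coeff_mul_monomial]
    rfl
  rw [Finset.sum_congr rfl hterm, Finset.sum_range_succ, ← Finset.sum_range_reflect,
    Finset.sum_range] at hcoef
  refine ⟨q, by omega, fun k => Polynomial.coeff (P.coeff (q - 1 - k.1) : Polynomial R) (k.1 + 1),
    fun k => (P.coeff (q - 1 - k.1)).2 _, ?_⟩
  rw [add_comm, ← hcoef]
  congr 1
  · refine Finset.sum_congr rfl fun k _ => ?_
    have : q - (q - 1 - k.1) = k.1 + 1 := by have := k.2; omega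
    rw [this]
  · have : P.coeff q = 1 := hPm
    rw [this]; simp

/-- Rational convex combinations. -/
lemma monom_pow_mem {n : ℕ} {M : Ideal (MPoly n)} {α : Fin n → ℕ} (hα : castV α ∈ NP M) :
    ∃ k : ℕ, 0 < k ∧ monom α ^ k ∈ M ^ k := by
  obtain ⟨ι, _, z, w, hz, haff, hw, hw1, hsum⟩ := eq_pos_convex_span_of_mem_convexHull hα
  have hz' : ∀ i, ∃ β : Fin n → ℕ, monom β ∈ M ∧ z i = castV β := fun i => hz ⟨i, rfl⟩
  choose β hβ hzβ using hz'
  obtain ⟨φ, hφ⟩ := LinearMap.exists_leftInverse_of_injective (Algebra.linearMap ℚ ℝ)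
    (LinearMap.ker_eq_bot.2 (algebraMap ℚ ℝ).injective)
  have hφq : ∀ r : ℚ, φ (r : ℝ) = r := fun r => by
    simpa using LinearMap.congr_fun hφ r
  have hφn : ∀ r : ℕ, φ (r : ℝ) = r := fun r => by
    have := hφq r; simpa using this
  have hcoord : ∀ j, ∑ i, w i * (β i j : ℝ) = (α j : ℝ) := by
    intro j
    have := congrFun hsum j
    simpa [hzβ, castV] using this
  have hcoordq : ∀ j, ∑ i, φ (w i) * (β i j : ℚ) = (α j : ℚ) := by
    intro j
    have := congrArg φ (hcoord j)
    rw [map_sum, hφn] at this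
    rw [← this]
    refine Finset.sum_congr rfl fun i _ => ?_
    rw [mul_comm, mul_comm (w i), ← nsmul_eq_mul, ← nsmul_eq_mul, map_nsmul]
  have hq1 : ∑ i, φ (w i) = 1 := by
    have := congrArg φ hw1
    rw [map_sum] at this
    rw [this]; simpa using hφn 1
  have hwφ : ∀ i, ((φ (w i) : ℚ) : ℝ) = w i := by
    rw [affineIndependent_iff] at haff
    intro i
    have := haff Finset.univ (fun i => ((φ (w i) : ℚ) : ℝ) - w i) ?_ ?_ i (Finset.mem_univ i)
    · linarith
    · rw [Finset.sum_sub_distrib, hw1, ← Rat.cast_sum, hq1]; simp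
    · simp only [sub_smul]
      rw [Finset.sum_sub_distrib, hsum, sub_eq_zero]
      ext j
      have := congrArg (fun r : ℚ => (r : ℝ)) (hcoordq j)
      simp only [Rat.cast_sum, Rat.cast_mul, Rat.cast_natCast] at this
      simpa [hzβ, castV] using this
  have hpos : ∀ i, 0 < φ (w i) := by
    intro i
    have := hw i
    rw [← hwφ i] at this
    exact_mod_cast this
  let k : ℕ := ∏ i, (φ (w i)).den
  have hk : 0 < k := Finset.prod_pos fun i _ => (φ (w i)).den_pos
  have ha : ∀ i, ∃ a : ℕ, (a : ℚ) = k * φ (w i) := by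
    intro i
    obtain ⟨c, hc⟩ : (φ (w i)).den ∣ k := Finset.dvd_prod_of_mem _ (Finset.mem_univ i)
    have hnum : 0 < (φ (w i)).num := Rat.num_pos.2 (hpos i)
    refine ⟨c * (φ (w i)).num.toNat, ?_⟩
    have h1 : (((φ (w i)).num.toNat : ℕ) : ℚ) = ((φ (w i)).num : ℚ) := by
      have : (((φ (w i)).num.toNat : ℕ) : ℤ) = (φ (w i)).num := Int.toNat_of_nonneg hnum.le
      exact_mod_cast this
    rw [hc]
    push_cast
    rw [h1, ← Rat.den_mul_eq_num]
    ring
  choose a ha using ha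
  have hsa : ∑ i, a i = k := by
    have : ((∑ i, a i : ℕ) : ℚ) = k := by
      push_cast
      simp only [ha]
      rw [← Finset.mul_sum, hq1, mul_one]
    exact_mod_cast this
  have hca : ∀ j, ∑ i, β i j * a i = α j * k := by
    intro j
    have : ((∑ i, β i j * a i : ℕ) : ℚ) = ((α j * k : ℕ) : ℚ) := by
      push_cast
      simp only [ha]
      rw [← hcoordq, Finset.sum_mul]
      exact Finset.sum_congr rfl fun i _ => by ring
    exact_mod_cast this
  refine ⟨k, hk, ?_⟩
  have : monom α ^ k = ∏ i, monom (β i) ^ a i := by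
    simp only [monom, ← Finset.prod_pow, ← pow_mul]
    rw [Finset.prod_comm]
    refine Finset.prod_congr rfl fun j _ => ?_
    rw [Finset.prod_pow_eq_pow_sum, hca]
  rw [this, ← hsa, ← Finset.prod_pow_eq_pow_sum]
  exact Ideal.prod_mem_prod fun i _ => Ideal.pow_mem_pow (hβ i) _

lemma partB {n : ℕ} {M : Ideal (MPoly n)} {J : Ideal (MPoly n)}
    (hJ : J = Ideal.span
      {p : MPoly n | ∃ α : Fin n → ℕ, (fun i => (α i : ℝ)) ∈ NP M ∧ p = monom α})
    (g : MPoly n) (hg : g ∈ J) : memIntClosure M g := by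
  apply memIntClosure_of_isIntegral
  rw [hJ] at hg
  refine Submodule.span_induction ?_ ?_ ?_ ?_ hg
  · rintro _ ⟨α, hα, rfl⟩
    obtain ⟨k, hk, hmem⟩ := monom_pow_mem hα
    refine IsIntegral.of_pow hk ?_
    rw [Polynomial.monomial_pow, one_mul]
    exact isIntegral_algebraMap (R := reesAlgebra M)
      (x := ⟨_, reesAlgebra.monomial_mem.2 hmem⟩)
  · rw [Polynomial.monomial_zero_right]; exact isIntegral_zero
  · intro x y _ _ hx hy
    rw [map_add]; exact hx.add hy
  · intro a x _ hx
    have : (Polynomial.monomial 1 (a • x) : Polynomial (MPoly n)) =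
        Polynomial.C a * Polynomial.monomial 1 x := by
      rw [Polynomial.C_mul_monomial, smul_eq_mul]
    rw [this]
    refine IsIntegral.mul ?_ hx
    exact isIntegral_algebraMap (R := reesAlgebra M)
      (x := algebraMap (MPoly n) (reesAlgebra M) a)

/-- The monomial ideal generated by {z^α : α ∈ NP(M) ∩ ℕ^n} is integrally
closed and equals the integral closure of M; in particular the integral closure
of a monomial ideal is again a monomial ideal. -/
theorem stmt15 (n : ℕ) (G : Set (Fin n → ℕ)) (M : Ideal (MPoly n))
    (hM : M = Ideal.span ((fun β => monom β) '' G))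
    (J : Ideal (MPoly n))
    (hJ : J = Ideal.span
      {p : MPoly n | ∃ α : Fin n → ℕ, (fun i => (α i : ℝ)) ∈ NP M ∧ p = monom α}) :
    (∀ g, memIntClosure J g → g ∈ J) ∧
    (∀ g, g ∈ J ↔ memIntClosure M g) := by
  refine ⟨partA hJ, fun g => ⟨partB hJ g, fun hg => partA hJ g ?_⟩⟩
  have hMJ : M ≤ J := by
    conv_lhs => rw [hM]
    rw [Ideal.span_le]
    rintro _ ⟨β, hβ, rfl⟩
    rw [hJ]
    refine Ideal.subset_span ⟨β, subset_convexHull ℝ _ ⟨β, ?_, rfl⟩, rfl⟩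
    rw [hM]
    exact Ideal.subset_span ⟨β, hβ, rfl⟩
  obtain ⟨q, hq, h, hh, heq⟩ := hg
  exact ⟨q, hq, h, fun k => Ideal.pow_right_mono hMJ _ (hh k), heq⟩
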